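/- arXiv:2201.04678 — 2 statements merged into one kernel-verified Lean document; each statement's English description precedes it below -/
import Mathlib

section
/- Let G and H be connected graphs, let M be a nonempty proper module of G, and let G' be the graph obtained from G by replacing G[M] with H. If the minimum dominating set of G[M] and the minimum dominating set of H have the same size, then the size of a minimum dominating set of G' is at most the size of a minimum dominating set of G. -/
open SimpleGraph Set

/-- `M` is a module of `G`: every vertex outside `M` is adjacent to all of `M`
or to none of `M`. -/
def SimpleGraph.IsModuleSet {V : Type*} (G : SimpleGraph V) (M : Set V) : Prop :=
  ∀ v ∉ M, (∀ m ∈ M, G.Adj v m) ∨ (∀ m ∈ M, ¬ G.Adj v m)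

/-- The graph obtained from `G` by replacing `G[M]` with `H`: its vertices are
`(V ∖ M) ⊕ V(H)`, with the edges of `G` outside `M`, the edges of `H`, and all
edges between `N_G(M) ∖ M` and `V(H)`. -/
def modularReplacement {V W : Type*} (G : SimpleGraph V) (M : Set V)
    (H : SimpleGraph W) : SimpleGraph ({v : V // v ∉ M} ⊕ W) :=
  SimpleGraph.fromRel (fun x y =>
    match x, y with
    | Sum.inl u, Sum.inl v => G.Adj u.1 v.1
    | Sum.inl u, Sum.inr _ => ∃ m ∈ M, G.Adj u.1 m
    | Sum.inr _, Sum.inl _ => False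
    | Sum.inr u, Sum.inr v => H.Adj u v)

section Invariants

variable {V : Type*} (G : SimpleGraph V)

/-- A dominating set. -/
def IsDomSet (D : Set V) : Prop := ∀ v ∉ D, ∃ u ∈ D, G.Adj v u

/-- A minimum dominating set. -/
def IsMinDomSet (D : Set V) : Prop :=
  IsDomSet G D ∧ ∀ D', IsDomSet G D' → D.ncard ≤ D'.ncard

/-- The domination number. -/
noncomputable def domNum : ℕ := sInf {n | ∃ D, IsDomSet G D ∧ D.ncard = n}

/-- A vertex cover. -/
def IsVCover (C : Set V) : Prop := ∀ ⦃u v⦄, G.Adj u v → u ∈ C ∨ v ∈ C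

/-- A minimum vertex cover. -/
def IsMinVCover (C : Set V) : Prop :=
  IsVCover G C ∧ ∀ C', IsVCover G C' → C.ncard ≤ C'.ncard

/-- The vertex cover number. -/
noncomputable def vcNum : ℕ := sInf {n | ∃ C, IsVCover G C ∧ C.ncard = n}

/-- A connected vertex cover. -/
def IsCVCover (C : Set V) : Prop := IsVCover G C ∧ (G.induce C).Connected

/-- A minimum connected vertex cover. -/
def IsMinCVCover (C : Set V) : Prop :=
  IsCVCover G C ∧ ∀ C', IsCVCover G C' → C.ncard ≤ C'.ncard

/-- The connected vertex cover number. -/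
noncomputable def cvcNum : ℕ := sInf {n | ∃ C, IsCVCover G C ∧ C.ncard = n}

/-- A feedback vertex set: its removal leaves an acyclic graph. -/
def IsFVS (S : Set V) : Prop := (G.induce Sᶜ).IsAcyclic

/-- A minimum feedback vertex set. -/
def IsMinFVS (S : Set V) : Prop :=
  IsFVS G S ∧ ∀ S', IsFVS G S' → S.ncard ≤ S'.ncard

/-- The feedback vertex set number. -/
noncomputable def fvsNum : ℕ := sInf {n | ∃ S, IsFVS G S ∧ S.ncard = n}

/-- An odd cycle transversal: its removal leaves a bipartite graph. -/
def IsOCT (S : Set V) : Prop := (G.induce Sᶜ).Colorable 2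

/-- A minimum odd cycle transversal. -/
def IsMinOCT (S : Set V) : Prop :=
  IsOCT G S ∧ ∀ S', IsOCT G S' → S.ncard ≤ S'.ncard

/-- The odd cycle transversal number. -/
noncomputable def octNum : ℕ := sInf {n | ∃ S, IsOCT G S ∧ S.ncard = n}

/-- An independent set: pairwise non-adjacent vertices. -/
def IsIndepSet' (I : Set V) : Prop := I.Pairwise (fun u v => ¬ G.Adj u v)

/-- A partition of `G` into `k` (vertex-disjoint) paths covering all vertices. -/
def IsPathPartition (k : ℕ) (P : Fin k → (u : V) × (v : V) × G.Walk u v) : Prop :=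
  (∀ i, (P i).2.2.IsPath) ∧
  (∀ i j, i ≠ j → ∀ x, x ∈ (P i).2.2.support → x ∉ (P j).2.2.support) ∧
  (∀ x : V, ∃ i, x ∈ (P i).2.2.support)

/-- The minimum number of paths in a partition of `G` into paths. -/
noncomputable def pathPartitionNum : ℕ :=
  sInf {k | ∃ P : Fin k → (u : V) × (v : V) × G.Walk u v, IsPathPartition G k P}

/-- `G` has a Hamiltonian cycle. -/
def HasHamCycle : Prop := ∃ (v : V) (p : G.Walk v v), p.IsCycle ∧ ∀ u : V, u ∈ p.support

/-- The number of vertices of a longest induced path of `G`. -/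
noncomputable def lipNum : ℕ :=
  sSup {n | ∃ S : Set V, Nonempty (G.induce S ≃g pathGraph n)}

/-- `X` is an induced matching with `k` edges: `X` has `2k` vertices and the
subgraph induced by `X` is `1`-regular. -/
def IsInducedMatching (X : Set V) (k : ℕ) : Prop :=
  X.ncard = 2 * k ∧ ∀ v ∈ X, ∃! u, u ∈ X ∧ G.Adj v u

/-- The maximum number of edges of an induced matching of `G`. -/
noncomputable def imNum : ℕ := sSup {k | ∃ X, IsInducedMatching G X k}

/-- An independent triangle packing with `k` triangles: pairwise disjoint
triangles with no edges of `G` between different triangles. -/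
def IsIndepTrianglePacking (k : ℕ) (f : Fin k → Set V) : Prop :=
  (∀ i, ∃ a b c : V, f i = {a, b, c} ∧ G.Adj a b ∧ G.Adj a c ∧ G.Adj b c) ∧
  (∀ i j, i ≠ j → ∀ u ∈ f i, ∀ v ∈ f j, u ≠ v ∧ ¬ G.Adj u v)

/-- The maximum number of triangles in an independent triangle packing of `G`. -/
noncomputable def itpNum : ℕ :=
  sSup {k | ∃ f : Fin k → Set V, IsIndepTrianglePacking G k f}

/-- `C` is the vertex set of an induced cycle of `G`. -/
def IsCycleSet (C : Set V) : Prop :=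
  3 ≤ C.ncard ∧ (G.induce C).Connected ∧ ∀ v ∈ C, {u | u ∈ C ∧ G.Adj v u}.ncard = 2

/-- An independent cycle packing with `k` cycles: pairwise disjoint induced
cycles with no edges of `G` between different cycles. -/
def IsIndepCyclePacking (k : ℕ) (f : Fin k → Set V) : Prop :=
  (∀ i, IsCycleSet G (f i)) ∧
  (∀ i j, i ≠ j → ∀ u ∈ f i, ∀ v ∈ f j, u ≠ v ∧ ¬ G.Adj u v)

/-- The maximum number of cycles in an independent cycle packing of `G`. -/
noncomputable def icpNum : ℕ :=
  sSup {k | ∃ f : Fin k → Set V, IsIndepCyclePacking G k f}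

end Invariants

theorem domNum_le_ncard {V : Type*} {G : SimpleGraph V} {D : Set V} (hD : IsDomSet G D) :
    domNum G ≤ D.ncard :=
  Nat.sInf_le ⟨D, hD, rfl⟩

theorem exists_isDomSet_ncard_eq_domNum {V : Type*} (G : SimpleGraph V) :
    ∃ D, IsDomSet G D ∧ D.ncard = domNum G :=
  Nat.sInf_mem (s := {n | ∃ D, IsDomSet G D ∧ D.ncard = n})
    ⟨_, Set.univ, fun v hv => absurd (Set.mem_univ v) hv, rfl⟩

theorem IsDomSet.nonempty {V : Type*} [Nonempty V] {G : SimpleGraph V} {D : Set V}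
    (hD : IsDomSet G D) : D.Nonempty := by
  obtain ⟨v⟩ := ‹Nonempty V›
  by_cases hv : v ∈ D
  · exact ⟨v, hv⟩
  · obtain ⟨u, hu, -⟩ := hD v hv
    exact ⟨u, hu⟩

section ModularReplacement

variable {V W : Type*} {G : SimpleGraph V} {M : Set V} {H : SimpleGraph W}

theorem modularReplacement_adj_inl_inl {u v : {v : V // v ∉ M}} :
    (modularReplacement G M H).Adj (Sum.inl u) (Sum.inl v) ↔ G.Adj u.1 v.1 := by
  simp only [modularReplacement, SimpleGraph.fromRel_adj]
  refine ⟨fun h => h.2.elim id fun h => h.symm, fun h => ⟨fun e => ?_, Or.inl h⟩⟩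
  exact h.ne (congrArg Subtype.val (Sum.inl_injective e))

theorem modularReplacement_adj_inl_inr {u : {v : V // v ∉ M}} {w : W} :
    (modularReplacement G M H).Adj (Sum.inl u) (Sum.inr w) ↔ ∃ m ∈ M, G.Adj u.1 m := by
  simp [modularReplacement, SimpleGraph.fromRel_adj]

theorem modularReplacement_adj_inr_inr {u v : W} :
    (modularReplacement G M H).Adj (Sum.inr u) (Sum.inr v) ↔ H.Adj u v := by
  simp only [modularReplacement, SimpleGraph.fromRel_adj]
  refine ⟨fun h => h.2.elim id fun h => h.symm, fun h => ⟨fun e => ?_, Or.inl h⟩⟩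
  exact h.ne (Sum.inr_injective e)

/-- Replacing the part of a dominating set inside `M` by a subset `S` of the vertices of `H` gives
a dominating set of the modular replacement, as soon as `S` takes over the role of `D ∩ M` outside
`M`, and the vertices of `H` are dominated from inside or from outside. -/
theorem IsDomSet.modularReplacement {D : Set V} (hD : IsDomSet G D) {S : Set W}
    (hne : (D ∩ M).Nonempty → S.Nonempty)
    (hS : IsDomSet H S ∨ ∃ x ∈ D, x ∉ M ∧ ∃ m ∈ M, G.Adj x m) :
    IsDomSet (modularReplacement G M H)
      (Sum.inl '' (Subtype.val ⁻¹' D : Set {v : V // v ∉ M}) ∪ Sum.inr '' S) := by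
  rintro (u | w) hv
  · have hu : u.1 ∉ D := fun h => hv (Or.inl ⟨u, h, rfl⟩)
    obtain ⟨d, hd, hadj⟩ := hD u.1 hu
    by_cases hdM : d ∈ M
    · obtain ⟨s, hs⟩ := hne ⟨d, hd, hdM⟩
      exact ⟨Sum.inr s, Or.inr ⟨s, hs, rfl⟩, modularReplacement_adj_inl_inr.2 ⟨d, hdM, hadj⟩⟩
    · exact ⟨Sum.inl ⟨d, hdM⟩, Or.inl ⟨_, hd, rfl⟩, modularReplacement_adj_inl_inl.2 hadj⟩
  · rcases hS with hS | ⟨x, hx, hxM, hadj⟩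
    · obtain ⟨s, hs, hadj⟩ := hS w fun h => hv (Or.inr ⟨w, h, rfl⟩)
      exact ⟨Sum.inr s, Or.inr ⟨s, hs, rfl⟩, modularReplacement_adj_inr_inr.2 hadj⟩
    · exact ⟨Sum.inl ⟨x, hxM⟩, Or.inl ⟨_, hx, rfl⟩,
        (modularReplacement_adj_inl_inr.2 hadj).symm⟩

end ModularReplacement

/-- If the part of a dominating set inside a module `M` does not dominate `G[M]`, then the
dominating set contains a vertex outside `M` with a neighbor in `M`. -/
theorem IsDomSet.exists_adj_of_not_isDomSet_induce {V : Type*} {G : SimpleGraph V} {M D : Set V}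
    (hD : IsDomSet G D) (h : ¬ IsDomSet (G.induce M) (Subtype.val ⁻¹' D)) :
    ∃ x ∈ D, x ∉ M ∧ ∃ m ∈ M, G.Adj x m := by
  simp only [IsDomSet, not_forall] at h
  obtain ⟨m, hm, hnot⟩ := h
  obtain ⟨x, hx, hadj⟩ := hD m.1 hm
  exact ⟨x, hx, fun hxM => hnot ⟨⟨x, hxM⟩, hx, hadj⟩, m.1, m.2, hadj.symm⟩

theorem stmt9 {V W : Type*} [Fintype V] [Fintype W]
    (G : SimpleGraph V) (H : SimpleGraph W) (M : Set V)
    (hG : G.Connected) (hH : H.Connected)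
    (hMod : G.IsModuleSet M) (hne : M.Nonempty) (hproper : M ≠ Set.univ)
    (hdom : domNum (G.induce M) = domNum H) :
    domNum (modularReplacement G M H) ≤ domNum G := by
  have : Nonempty W := hH.nonempty
  obtain ⟨D, hD, hcard⟩ := exists_isDomSet_ncard_eq_domNum G
  have ncard_preimage (N : Set V) : (Subtype.val ⁻¹' D : Set N).ncard = (D ∩ N).ncard := by
    rw [← Set.ncard_image_of_injective _ Subtype.val_injective, Subtype.image_preimage_coe,
      Set.inter_comm]
  obtain ⟨S, hS_ne, hS_card, hS⟩ : ∃ S : Set W, ((D ∩ M).Nonempty → S.Nonempty) ∧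
      S.ncard ≤ (D ∩ M).ncard ∧ (IsDomSet H S ∨ ∃ x ∈ D, x ∉ M ∧ ∃ m ∈ M, G.Adj x m) := by
    by_cases h : IsDomSet (G.induce M) (Subtype.val ⁻¹' D)
    · obtain ⟨S, hS, hS_card⟩ := exists_isDomSet_ncard_eq_domNum H
      refine ⟨S, fun _ => hS.nonempty, ?_, Or.inl hS⟩
      rw [hS_card, ← hdom, ← ncard_preimage]
      exact domNum_le_ncard h
    · have hx := hD.exists_adj_of_not_isDomSet_induce h
      rcases (D ∩ M).eq_empty_or_nonempty with hDM | hDM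
      · exact ⟨∅, fun h => absurd hDM h.ne_empty, by simp, Or.inr hx⟩
      · obtain ⟨w⟩ := ‹Nonempty W›
        refine ⟨{w}, fun _ => Set.singleton_nonempty w, ?_, Or.inr hx⟩
        rw [Set.ncard_singleton]
        exact (Set.ncard_pos).2 hDM
  calc domNum (modularReplacement G M H)
      ≤ _ := domNum_le_ncard (hD.modularReplacement hS_ne hS)
    _ ≤ (D ∩ Mᶜ).ncard + S.ncard := by
        refine (Set.ncard_union_le _ _).trans ?_
        rw [Set.ncard_image_of_injective _ Sum.inl_injective,
          Set.ncard_image_of_injective _ Sum.inr_injective]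
        exact Nat.add_le_add_right (ncard_preimage Mᶜ).le _
    _ ≤ (D ∩ Mᶜ).ncard + (D ∩ M).ncard := Nat.add_le_add_left hS_card _
    _ = domNum G := by
        rw [← hcard, add_comm, ← Set.sdiff_eq, Set.ncard_inter_add_ncard_sdiff_eq_ncard]
end

section
/- Let G and H be connected graphs, let M be a nonempty proper module of G, and let G' be the graph obtained from G by replacing G[M] with H. If |M| = |V(H)|, the minimum vertex covers of G[M] and of H have the same size, and the minimum odd cycle transversals of G[M] and of H have the same size, then the size of a minimum odd cycle transversal of G' is at most the size of a minimum odd cycle transversal of G. -/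
open SimpleGraph Set

theorem isOCT_iff_exists_bool {V : Type*} (G : SimpleGraph V) (S : Set V) :
    IsOCT G S ↔ ∃ c : V → Bool, ∀ u v, u ∉ S → v ∉ S → G.Adj u v → c u ≠ c v := by
  classical
  constructor
  · rintro ⟨c⟩
    refine ⟨fun v => if h : v ∈ Sᶜ then decide (c ⟨v, h⟩ = 0) else false, ?_⟩
    intro u v hu hv huv
    have hc : c ⟨u, hu⟩ ≠ c ⟨v, hv⟩ := c.valid (by simpa using huv)
    simp only [mem_compl_iff, hu, hv, not_false_eq_true, dite_true, ne_eq, decide_eq_decide]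
    omega
  · rintro ⟨c, hc⟩
    have col : (G.induce Sᶜ).Coloring Bool :=
      Coloring.mk (fun v => c v.1) (fun {u v} huv => hc u v u.2 v.2 (by simpa using huv))
    simpa [IsOCT] using col.colorable

theorem octNum_le {V : Type*} {G : SimpleGraph V} {S : Set V} (h : IsOCT G S) :
    octNum G ≤ S.ncard :=
  Nat.sInf_le ⟨S, h, rfl⟩

theorem vcNum_le {V : Type*} {G : SimpleGraph V} {C : Set V} (h : IsVCover G C) :
    vcNum G ≤ C.ncard :=
  Nat.sInf_le ⟨C, h, rfl⟩

theorem exists_isOCT_ncard_eq_octNum {V : Type*} (G : SimpleGraph V) :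
    ∃ S, IsOCT G S ∧ S.ncard = octNum G := by
  refine Nat.sInf_mem (s := {n | ∃ S, IsOCT G S ∧ S.ncard = n}) ⟨_, univ, ?_, rfl⟩
  exact (isOCT_iff_exists_bool G univ).2 ⟨fun _ => false, fun u _ hu => absurd (mem_univ u) hu⟩

theorem exists_isVCover_ncard_eq_vcNum {V : Type*} (G : SimpleGraph V) :
    ∃ C, IsVCover G C ∧ C.ncard = vcNum G :=
  Nat.sInf_mem (s := {n | ∃ C, IsVCover G C ∧ C.ncard = n})
    ⟨_, univ, fun u _ _ => Or.inl (mem_univ u), rfl⟩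

/-- Compatible bipartitions of `G - S` outside `M` and of `H - T` combine to a bipartition of the
modular replacement. -/
theorem octNum_modularReplacement_le {V W : Type*} [Finite V] [Finite W]
    {G : SimpleGraph V} {H : SimpleGraph W} {M S : Set V} {T : Set W}
    (hT : T.ncard ≤ (M ∩ S).ncard) {c : V → Bool} {d : W → Bool}
    (hc : ∀ u v, u ∉ S → v ∉ S → G.Adj u v → c u ≠ c v)
    (hd : ∀ u v, u ∉ T → v ∉ T → H.Adj u v → d u ≠ d v)
    (hcd : ∀ u, u ∉ S → (∃ m ∈ M, G.Adj u m) → ∀ w, w ∉ T → u ∉ M → c u ≠ d w) :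
    octNum (modularReplacement G M H) ≤ S.ncard := by
  let A : Set {v : V // v ∉ M} := Subtype.val ⁻¹' S
  have hA : A.ncard = (S \ M).ncard := by
    rw [← ncard_image_of_injective A Subtype.val_injective]
    congr 1
    ext v
    simp [A, and_comm]
  have hcardle : (Sum.inl '' A ∪ Sum.inr '' T : Set ({v : V // v ∉ M} ⊕ W)).ncard ≤ S.ncard := by
    have h1 := ncard_union_le (Sum.inl '' A : Set ({v : V // v ∉ M} ⊕ W)) (Sum.inr '' T)
    rw [ncard_image_of_injective _ Sum.inl_injective,
      ncard_image_of_injective _ Sum.inr_injective] at h1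
    have h2 := ncard_inter_add_ncard_sdiff_eq_ncard S M
    rw [inter_comm] at h2
    omega
  refine (octNum_le ((isOCT_iff_exists_bool _ _).2
    ⟨Sum.elim (fun v => c v.1) d, ?_⟩)).trans hcardle
  rintro (⟨u, hu⟩ | u) (⟨v, hv⟩ | v) hx hy hxy <;>
    simp [A, modularReplacement] at hx hy hxy ⊢
  · exact hc u v hx hy (hxy.2.elim id SimpleGraph.Adj.symm)
  · exact hcd u hx hxy v hy hu
  · exact (hcd v hy hxy u hx hv).symm
  · exact hd u v hx hy (hxy.2.elim id SimpleGraph.Adj.symm)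

theorem stmt13 {V W : Type*} [Fintype V] [Fintype W]
    (G : SimpleGraph V) (H : SimpleGraph W) (M : Set V)
    (hG : G.Connected) (hH : H.Connected)
    (hMod : G.IsModuleSet M) (hne : M.Nonempty) (hproper : M ≠ Set.univ)
    (hcard : M.ncard = Fintype.card W)
    (hvc : vcNum (G.induce M) = vcNum H)
    (hoct : octNum (G.induce M) = octNum H) :
    octNum (modularReplacement G M H) ≤ octNum G := by
  obtain ⟨S, hS, hScard⟩ := exists_isOCT_ncard_eq_octNum G
  obtain ⟨c, hc⟩ := (isOCT_iff_exists_bool G S).1 hS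
  rw [← hScard]
  have hpre : (Subtype.val ⁻¹' S : Set M).ncard = (M ∩ S).ncard := by
    rw [← ncard_image_of_injective _ Subtype.val_injective, Subtype.image_preimage_coe]
  have hadj : ∀ u, u ∉ M → (∃ m ∈ M, G.Adj u m) → ∀ m ∈ M, G.Adj u m := by
    rintro u hu ⟨m, hm, hum⟩
    exact (hMod u hu).resolve_right fun h => h m hm hum
  by_cases hedge : ∃ a ∈ M, ∃ b ∈ M, a ∉ S ∧ b ∉ S ∧ G.Adj a b
  · obtain ⟨a, ha, b, hb, haS, hbS, hab⟩ := hedge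
    obtain ⟨T, hT, hTcard⟩ := exists_isOCT_ncard_eq_octNum H
    obtain ⟨d, hd⟩ := (isOCT_iff_exists_bool H T).1 hT
    refine octNum_modularReplacement_le (T := T) ?_ hc hd ?_
    · rw [hTcard, ← hoct, ← hpre]
      refine octNum_le ((isOCT_iff_exists_bool _ _).2 ⟨fun v => c v.1, ?_⟩)
      exact fun u v hu hv huv => hc u v hu hv (by simpa using huv)
    · intro u hu hm _ _ huM
      have h := hadj u huM hm
      have h1 := hc u a hu haS (h a ha)
      have h2 := hc u b hu hbS (h b hb)
      have h3 := hc a b haS hbS hab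
      exact absurd ((Bool.eq_not.2 h1.symm).trans (Bool.eq_not.2 h2.symm).symm) h3
  · by_cases hsub : M ⊆ S
    · refine octNum_modularReplacement_le (T := univ) (d := fun _ => false) ?_ hc ?_ ?_
      · rw [inter_eq_left.2 hsub, hcard, ncard_univ, Nat.card_eq_fintype_card]
      · exact fun u _ hu => absurd (mem_univ u) hu
      · exact fun _ _ _ w hw => absurd (mem_univ w) hw
    · obtain ⟨r, hr, hrS⟩ := not_subset.1 hsub
      obtain ⟨C, hC, hCcard⟩ := exists_isVCover_ncard_eq_vcNum H
      refine octNum_modularReplacement_le (T := C) (d := fun _ => c r) ?_ hc ?_ ?_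
      · rw [hCcard, ← hvc, ← hpre]
        refine vcNum_le fun u v huv => ?_
        by_contra! h
        exact hedge ⟨u, u.2, v, v.2, h.1, h.2, by simpa using huv⟩
      · exact fun u v hu hv huv => ((hC huv).elim hu hv).elim
      · exact fun u hu hm _ _ huM => hc u r hu hrS (hadj u huM hm r hr)
end
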